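/- Let d be a positive integer, let ρ' and ρ be d×d positive definite Hermitian complex matrices with Tr ρ' = Tr ρ = 1, and let Q be a d×d Hermitian matrix. Set x := Re Tr[(ρ'−ρ)Q], v' := Var_{ρ'}(Q), v := Var_ρ(Q), and assume (1−λ)v' + λv + λ(1−λ)x² > 0 for all λ ∈ (0,1). Then D(ρ'‖ρ) ≥ ∫₀¹ λ · x² / ((1−λ)v' + λv + λ(1−λ)x²) dλ. -/

import Mathlib

open Matrix MeasureTheory
open scoped ComplexOrder

/-- Matrix logarithm of a Hermitian positive definite matrix via the spectral
decomposition (continuous functional calculus); junk value `0` otherwise. -/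
noncomputable def matLog {n : Type*} [Fintype n] [DecidableEq n]
    (A : Matrix n n ℂ) : Matrix n n ℂ :=
  if hA : A.IsHermitian then
    (hA.eigenvectorUnitary : Matrix n n ℂ) *
      Matrix.diagonal (fun i => (Real.log (hA.eigenvalues i) : ℂ)) *
      (star (hA.eigenvectorUnitary : Matrix n n ℂ))
  else 0

/-- Quantum relative entropy `D(ρ‖σ) = Re Tr[ρ (log ρ − log σ)]`. -/
noncomputable def qRelEnt {n : Type*} [Fintype n] [DecidableEq n]
    (ρ σ : Matrix n n ℂ) : ℝ :=
  (Matrix.trace (ρ * (matLog ρ - matLog σ))).re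

/-- Variance `Var_ρ(Q) := Re Tr[ρ (Q − Re Tr(ρQ)·I)²]`. -/
noncomputable def qVar {n : Type*} [Fintype n] [DecidableEq n]
    (ρ Q : Matrix n n ℂ) : ℝ :=
  (Matrix.trace (ρ * ((Q - (((Matrix.trace (ρ * Q)).re : ℝ) : ℂ) • 1) *
      (Q - (((Matrix.trace (ρ * Q)).re : ℝ) : ℂ) • 1)))).re

/-- The entropy density `p log (p / q) - p + q` as an integral over the mixtures of `p` and `q`. -/
theorem intervalIntegrable_and_integral_eq_mul_log_sub {p q : ℝ} (hp : 0 < p) (hq : 0 < q) :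
    IntervalIntegrable (fun t => t * ((p - q) ^ 2 / ((1 - t) * p + t * q))) volume 0 1 ∧
      ∫ t in (0 : ℝ)..1, t * ((p - q) ^ 2 / ((1 - t) * p + t * q)) =
        p * Real.log p - p * Real.log q - p + q := by
  have hpos : ∀ t ∈ Set.uIcc (0 : ℝ) 1, 0 < (1 - t) * p + t * q := by
    intro t ht
    rw [Set.uIcc_of_le zero_le_one] at ht
    rcases ht.1.eq_or_lt with rfl | h
    · simpa using hp
    · have := mul_pos h hq
      have := mul_nonneg (sub_nonneg.2 ht.2) hp.le
      linarith
  have hint : IntervalIntegrable (fun t => t * ((p - q) ^ 2 / ((1 - t) * p + t * q)))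
      volume 0 1 := by
    apply ContinuousOn.intervalIntegrable
    refine continuousOn_id.mul (ContinuousOn.div (by fun_prop) (by fun_prop) ?_)
    exact fun t ht => (hpos t ht).ne'
  refine ⟨hint, ?_⟩
  have hderiv : ∀ t ∈ Set.uIcc (0 : ℝ) 1,
      HasDerivAt (fun t => -(p - q) * t - p * Real.log ((1 - t) * p + t * q))
        (t * ((p - q) ^ 2 / ((1 - t) * p + t * q))) t := by
    intro t ht
    have hne := (hpos t ht).ne'
    have hlin : HasDerivAt (fun t : ℝ => (1 - t) * p + t * q) (-1 * p + 1 * q) t :=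
      (((hasDerivAt_id t).const_sub 1).mul_const p).add ((hasDerivAt_id t).mul_const q)
    refine (((hasDerivAt_id t).const_mul (-(p - q))).sub
      ((hlin.log hne).const_mul p)).congr_deriv ?_
    have hmix : t * (p - q) = p - ((1 - t) * p + t * q) := by ring
    generalize (1 - t) * p + t * q = m at hne hmix
    field_simp
    linear_combination (q - p) * hmix
  rw [intervalIntegral.integral_eq_sub_of_hasDerivAt hderiv hint]
  simp
  ring

namespace Matrix

variable {n : Type*} [Fintype n] [DecidableEq n]

theorem re_trace_diagonal_mul_mul_diagonal_mul_conjTranspose (a b : n → ℝ) (K : Matrix n n ℂ) :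
    (trace (diagonal (fun i => (a i : ℂ)) * K * diagonal (fun i => (b i : ℂ)) * Kᴴ)).re =
      ∑ i, ∑ j, a i * b j * Complex.normSq (K i j) := by
  simp only [trace, diag_apply, mul_apply (N := Kᴴ), mul_diagonal, diagonal_mul, conjTranspose_apply,
    Complex.re_sum]
  refine Finset.sum_congr rfl fun i _ => Finset.sum_congr rfl fun j _ => ?_
  have : (a i : ℂ) * K i j * (b j : ℂ) * star (K i j) =
      ((a i * b j * Complex.normSq (K i j) : ℝ) : ℂ) := by
    push_cast
    rw [← Complex.mul_conj, ← Complex.star_def]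
    ring
  rw [this, Complex.ofReal_re]

theorem IsHermitian.eq_eigenvectorUnitary_mul_diagonal_mul {A : Matrix n n ℂ}
    (hA : A.IsHermitian) :
    A = (hA.eigenvectorUnitary : Matrix n n ℂ) * diagonal (fun i => (hA.eigenvalues i : ℂ)) *
      (hA.eigenvectorUnitary : Matrix n n ℂ)ᴴ :=
  hA.spectral_theorem

theorem IsHermitian.matLog_eq {A : Matrix n n ℂ} (hA : A.IsHermitian) :
    matLog A = (hA.eigenvectorUnitary : Matrix n n ℂ) *
      diagonal (fun i => (Real.log (hA.eigenvalues i) : ℂ)) *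
      (hA.eigenvectorUnitary : Matrix n n ℂ)ᴴ := by
  rw [matLog, dif_pos hA, star_eq_conjTranspose]

theorem re_trace_conj_diagonal_mul (U W X : Matrix n n ℂ) (a b : n → ℝ) :
    (trace (U * diagonal (fun i => (a i : ℂ)) * Uᴴ * X *
      (W * diagonal (fun i => (b i : ℂ)) * Wᴴ) * Xᴴ)).re =
      ∑ i, ∑ j, a i * b j * Complex.normSq ((Uᴴ * X * W) i j) := by
  rw [← re_trace_diagonal_mul_mul_diagonal_mul_conjTranspose]
  simp only [conjTranspose_mul, conjTranspose_conjTranspose, mul_assoc]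
  rw [trace_mul_comm]
  simp only [mul_assoc]

/-- The transition matrix between the eigenbases of `A` and `B`, with `X` inserted. -/
noncomputable def IsHermitian.overlap {A B : Matrix n n ℂ} (hA : A.IsHermitian)
    (hB : B.IsHermitian) (X : Matrix n n ℂ) : Matrix n n ℂ :=
  (hA.eigenvectorUnitary : Matrix n n ℂ)ᴴ * X * (hB.eigenvectorUnitary : Matrix n n ℂ)

theorem IsHermitian.eigenvectorUnitary_mul_conjTranspose {A : Matrix n n ℂ}
    (hA : A.IsHermitian) :
    (hA.eigenvectorUnitary : Matrix n n ℂ) * (hA.eigenvectorUnitary : Matrix n n ℂ)ᴴ = 1 :=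
  Unitary.coe_mul_star_self _

theorem IsHermitian.eigenvectorUnitary_conjTranspose_mul {A : Matrix n n ℂ}
    (hA : A.IsHermitian) :
    (hA.eigenvectorUnitary : Matrix n n ℂ)ᴴ * (hA.eigenvectorUnitary : Matrix n n ℂ) = 1 :=
  Unitary.coe_star_mul_self _

section Overlap

variable {A B X : Matrix n n ℂ} (hA : A.IsHermitian) (hB : B.IsHermitian)

theorem IsHermitian.conj_one :
    (hA.eigenvectorUnitary : Matrix n n ℂ) * diagonal (fun _ => ((1 : ℝ) : ℂ)) *
      (hA.eigenvectorUnitary : Matrix n n ℂ)ᴴ = 1 := by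
  simp [hA.eigenvectorUnitary_mul_conjTranspose]

theorem IsHermitian.re_trace_mul_sq_left (hX : X.IsHermitian) :
    (trace (A * (X * X))).re =
      ∑ i, ∑ j, hA.eigenvalues i * Complex.normSq (hA.overlap hB X i j) := by
  have h := re_trace_conj_diagonal_mul (hA.eigenvectorUnitary : Matrix n n ℂ)
    (hB.eigenvectorUnitary : Matrix n n ℂ) X hA.eigenvalues (fun _ => 1)
  rw [← hA.eq_eigenvectorUnitary_mul_diagonal_mul, hB.conj_one, hX.eq] at h
  simpa [overlap, Matrix.mul_assoc] using h

theorem IsHermitian.re_trace_mul_sq_right (hX : X.IsHermitian) :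
    (trace (B * (X * X))).re =
      ∑ i, ∑ j, hB.eigenvalues j * Complex.normSq (hA.overlap hB X i j) := by
  have h := re_trace_conj_diagonal_mul (hA.eigenvectorUnitary : Matrix n n ℂ)
    (hB.eigenvectorUnitary : Matrix n n ℂ) X (fun _ => 1) hB.eigenvalues
  rw [← hB.eq_eigenvectorUnitary_mul_diagonal_mul, hA.conj_one, hX.eq, Matrix.one_mul,
    Matrix.mul_assoc, trace_mul_comm] at h
  simpa [overlap, Matrix.mul_assoc] using h

theorem IsHermitian.re_trace_mul_matLog :
    (trace (A * matLog B)).re = ∑ i, ∑ j, hA.eigenvalues i * Real.log (hB.eigenvalues j) *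
      Complex.normSq (hA.overlap hB 1 i j) := by
  have h := re_trace_conj_diagonal_mul (hA.eigenvectorUnitary : Matrix n n ℂ)
    (hB.eigenvectorUnitary : Matrix n n ℂ) 1 hA.eigenvalues (fun j => Real.log (hB.eigenvalues j))
  rw [← hA.eq_eigenvectorUnitary_mul_diagonal_mul, ← hB.matLog_eq] at h
  simpa [overlap] using h

theorem IsHermitian.re_trace_mul_matLog_self :
    (trace (A * matLog A)).re = ∑ i, ∑ j, hA.eigenvalues i * Real.log (hA.eigenvalues i) *
      Complex.normSq (hA.overlap hB 1 i j) := by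
  have h := re_trace_conj_diagonal_mul (hA.eigenvectorUnitary : Matrix n n ℂ)
    (hB.eigenvectorUnitary : Matrix n n ℂ) 1
    (fun i => hA.eigenvalues i * Real.log (hA.eigenvalues i)) (fun _ => 1)
  rw [hB.conj_one] at h
  have hmul : A * matLog A = (hA.eigenvectorUnitary : Matrix n n ℂ) *
      diagonal (fun i => ((hA.eigenvalues i * Real.log (hA.eigenvalues i) : ℝ) : ℂ)) *
      (hA.eigenvectorUnitary : Matrix n n ℂ)ᴴ := by
    conv_lhs =>
      rw [hA.matLog_eq]
      enter [1]
      rw [hA.eq_eigenvectorUnitary_mul_diagonal_mul]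
    rw [Matrix.mul_assoc, Matrix.mul_assoc _ _ (_)ᴴ,
      ← Matrix.mul_assoc (_)ᴴ, hA.eigenvectorUnitary_conjTranspose_mul,
      Matrix.one_mul, ← Matrix.mul_assoc, Matrix.mul_assoc _ (diagonal _) (diagonal _),
      diagonal_mul_diagonal]
    simp [Matrix.mul_assoc]
  rw [hmul]
  simpa [overlap] using h

theorem IsHermitian.re_trace_sub_mul (hX : X.IsHermitian) :
    (trace ((A - B) * X)).re = ∑ i, ∑ j, ((hA.eigenvalues i - hB.eigenvalues j) *
      (hA.overlap hB 1 i j * star (hA.overlap hB X i j)).re) := by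
  have hconj : diagonal (fun i => (hA.eigenvalues i : ℂ)) * hA.overlap hB 1 -
      hA.overlap hB 1 * diagonal (fun j => (hB.eigenvalues j : ℂ)) = hA.overlap hB (A - B) := by
    have h₁ : hA.overlap hB A =
        diagonal (fun i => (hA.eigenvalues i : ℂ)) * hA.overlap hB 1 := by
      unfold overlap
      conv_lhs =>
        enter [1, 2]
        rw [hA.eq_eigenvectorUnitary_mul_diagonal_mul]
      simp only [← Matrix.mul_assoc, hA.eigenvectorUnitary_conjTranspose_mul, Matrix.one_mul,
        Matrix.mul_one]
    have h₂ : hA.overlap hB B =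
        hA.overlap hB 1 * diagonal (fun j => (hB.eigenvalues j : ℂ)) := by
      unfold overlap
      conv_lhs =>
        enter [1, 2]
        rw [hB.eq_eigenvectorUnitary_mul_diagonal_mul]
      simp only [Matrix.mul_assoc, hB.eigenvectorUnitary_conjTranspose_mul, Matrix.mul_one]
    rw [← h₁, ← h₂]
    simp [overlap, Matrix.mul_sub, Matrix.sub_mul]
  have htr : trace ((A - B) * X) = trace (hA.overlap hB (A - B) * (hA.overlap hB X)ᴴ) := by
    have hmul : hA.overlap hB (A - B) * (hA.overlap hB X)ᴴ =
        (hA.eigenvectorUnitary : Matrix n n ℂ)ᴴ *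
          ((A - B) * X * (hA.eigenvectorUnitary : Matrix n n ℂ)) := by
      simp only [overlap, conjTranspose_mul, conjTranspose_conjTranspose, hX.eq]
      simp only [Matrix.mul_assoc]
      rw [← Matrix.mul_assoc _ (_)ᴴ (X * _), hB.eigenvectorUnitary_mul_conjTranspose,
        Matrix.one_mul]
    rw [hmul, trace_mul_comm (hA.eigenvectorUnitary : Matrix n n ℂ)ᴴ, Matrix.mul_assoc, hA.eigenvectorUnitary_mul_conjTranspose,
      Matrix.mul_one]
  rw [htr, ← hconj]
  simp only [trace, diag_apply, mul_apply (N := (hA.overlap hB X)ᴴ), sub_apply, mul_diagonal, diagonal_mul,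
    conjTranspose_apply, Complex.re_sum]
  refine Finset.sum_congr rfl fun i _ => Finset.sum_congr rfl fun j _ => ?_
  rw [← Complex.re_ofReal_mul]
  push_cast
  congr 1
  ring

theorem qRelEnt_eq_sum (htr : A.trace = B.trace) :
    qRelEnt A B = ∑ i, ∑ j, Complex.normSq (hA.overlap hB 1 i j) *
      (hA.eigenvalues i * Real.log (hA.eigenvalues i) -
        hA.eigenvalues i * Real.log (hB.eigenvalues j) - hA.eigenvalues i + hB.eigenvalues j) := by
  have h₁ := hA.re_trace_mul_sq_left hB (X := 1) isHermitian_one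
  have h₂ := hA.re_trace_mul_sq_right hB (X := 1) isHermitian_one
  rw [Matrix.mul_one, Matrix.mul_one] at h₁ h₂
  have h : qRelEnt A B = (trace (A * matLog A)).re - (trace (A * matLog B)).re -
      A.trace.re + B.trace.re := by
    rw [qRelEnt, Matrix.mul_sub, trace_sub, Complex.sub_re, htr]
    ring
  rw [h, hA.re_trace_mul_matLog_self hB, hA.re_trace_mul_matLog hB, h₁, h₂]
  simp only [← Finset.sum_sub_distrib, ← Finset.sum_add_distrib]
  exact Finset.sum_congr rfl fun i _ => Finset.sum_congr rfl fun j _ => by ring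

end Overlap

theorem PosDef.sq_re_trace_sub_mul_le {A B X : Matrix n n ℂ} (hA : A.PosDef) (hB : B.PosDef)
    (hX : X.IsHermitian) {t : ℝ} (ht : t ∈ Set.Ioo (0 : ℝ) 1) :
    (trace ((A - B) * X)).re ^ 2 ≤
      (∑ i, ∑ j, Complex.normSq (hA.isHermitian.overlap hB.isHermitian 1 i j) *
        ((hA.isHermitian.eigenvalues i - hB.isHermitian.eigenvalues j) ^ 2 /
          ((1 - t) * hA.isHermitian.eigenvalues i + t * hB.isHermitian.eigenvalues j))) *
      ((1 - t) * (trace (A * (X * X))).re + t * (trace (B * (X * X))).re) := by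
  have hm : ∀ i j, 0 < (1 - t) * hA.isHermitian.eigenvalues i +
      t * hB.isHermitian.eigenvalues j := fun i j =>
    add_pos (mul_pos (sub_pos.2 ht.2) (hA.eigenvalues_pos i)) (mul_pos ht.1 (hB.eigenvalues_pos j))
  rw [hA.isHermitian.re_trace_sub_mul hB.isHermitian hX,
    hA.isHermitian.re_trace_mul_sq_left hB.isHermitian hX,
    hA.isHermitian.re_trace_mul_sq_right hB.isHermitian hX]
  conv_rhs =>
    enter [2]
    simp only [Finset.mul_sum, ← Finset.sum_add_distrib]
  simp only [← Fintype.sum_prod_type']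
  apply Finset.sum_sq_le_sum_mul_sum_of_sq_le_mul
  · exact fun k _ => mul_nonneg (Complex.normSq_nonneg _) (div_nonneg (sq_nonneg _) (hm _ _).le)
  · intro k _
    rw [← mul_assoc, ← mul_assoc, ← add_mul]
    exact mul_nonneg (hm _ _).le (Complex.normSq_nonneg _)
  · rintro ⟨i, j⟩ -
    have hre : ∀ z w : ℂ, (z * star w).re ^ 2 ≤ Complex.normSq z * Complex.normSq w := by
      intro z w
      have := Complex.re_sq_le_normSq (z * star w)
      rw [Complex.normSq_mul, Complex.star_def, Complex.normSq_conj] at this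
      rw [sq]
      exact this
    dsimp only
    rw [← mul_assoc, ← mul_assoc, ← add_mul, mul_pow]
    have hne := (hm i j).ne'
    refine (mul_le_mul_of_nonneg_left (hre _ _) (sq_nonneg _)).trans_eq ?_
    generalize (1 - t) * hA.isHermitian.eigenvalues i +
      t * hB.isHermitian.eigenvalues j = m at hne ⊢
    field_simp

theorem re_trace_mul_sub_smul_one_sq {A : Matrix n n ℂ} (htr : A.trace = 1) (Q : Matrix n n ℂ)
    (c : ℝ) :
    (trace (A * ((Q - (c : ℂ) • 1) * (Q - (c : ℂ) • 1)))).re =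
      (trace (A * (Q * Q))).re - 2 * c * (trace (A * Q)).re + c ^ 2 := by
  have h : A * ((Q - (c : ℂ) • 1) * (Q - (c : ℂ) • 1)) =
      A * (Q * Q) - (2 * c : ℂ) • (A * Q) + (c ^ 2 : ℂ) • A := by
    simp only [Matrix.mul_sub, Matrix.sub_mul, Matrix.smul_mul, Matrix.mul_smul, Matrix.mul_one,
      Matrix.one_mul]
    module
  rw [h, trace_add, trace_sub, trace_smul, trace_smul, htr]
  simp [sq]

end Matrix

/-- Scalar witness TUR for the quantum relative entropy:
`D(ρ'‖ρ) ≥ ∫₀¹ λ x² / ((1−λ)v' + λv + λ(1−λ)x²) dλ`. -/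
theorem witness_TUR_KL
    (d : ℕ) (hd : 0 < d)
    (ρ' ρ : Matrix (Fin d) (Fin d) ℂ)
    (hρ' : ρ'.PosDef) (hρ : ρ.PosDef)
    (hρ'tr : ρ'.trace = 1) (hρtr : ρ.trace = 1)
    (Q : Matrix (Fin d) (Fin d) ℂ) (hQ : Q.IsHermitian)
    (x v' v : ℝ)
    (hx : x = (Matrix.trace ((ρ' - ρ) * Q)).re)
    (hv' : v' = qVar ρ' Q) (hv : v = qVar ρ Q)
    (hden : ∀ lam ∈ Set.Ioo (0 : ℝ) 1,
      0 < (1 - lam) * v' + lam * v + lam * (1 - lam) * x ^ 2) :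
    qRelEnt ρ' ρ ≥
      ∫ lam in (0:ℝ)..1,
        lam * x ^ 2 / ((1 - lam) * v' + lam * v + lam * (1 - lam) * x ^ 2) := by
  have hshift : ∀ c : ℝ, (Q - (c : ℂ) • (1 : Matrix (Fin d) (Fin d) ℂ)).IsHermitian := fun c =>
    hQ.sub (by simp [IsHermitian, conjTranspose_smul])
  let w : Fin d → Fin d → ℝ := fun i j =>
    Complex.normSq (hρ'.isHermitian.overlap hρ.isHermitian 1 i j)
  let p := hρ'.isHermitian.eigenvalues
  let q := hρ.isHermitian.eigenvalues
  have hint := fun i j =>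
    intervalIntegrable_and_integral_eq_mul_log_sub (hρ'.eigenvalues_pos i)
      (hρ.eigenvalues_pos j)
  have hterm : ∀ i j, IntervalIntegrable
      (fun t => w i j * (t * ((p i - q j) ^ 2 / ((1 - t) * p i + t * q j)))) volume 0 1 :=
    fun i j => (hint i j).1.const_mul _
  have hsum : ∀ i, IntervalIntegrable
      (fun t => ∑ j, w i j * (t * ((p i - q j) ^ 2 / ((1 - t) * p i + t * q j)))) volume 0 1 := by
    intro i
    simpa only [Finset.sum_fn] using IntervalIntegrable.sum Finset.univ fun j _ => hterm i j
  have hfull : IntervalIntegrable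
      (fun t => ∑ i, ∑ j, w i j * (t * ((p i - q j) ^ 2 / ((1 - t) * p i + t * q j))))
      volume 0 1 := by
    simpa only [Finset.sum_fn] using IntervalIntegrable.sum Finset.univ fun i _ => hsum i
  have hent : qRelEnt ρ' ρ = ∫ t in (0 : ℝ)..1,
      ∑ i, ∑ j, w i j * (t * ((p i - q j) ^ 2 / ((1 - t) * p i + t * q j))) := by
    rw [qRelEnt_eq_sum hρ'.isHermitian hρ.isHermitian (hρ'tr.trans hρtr.symm),
      intervalIntegral.integral_finsetSum fun i _ => hsum i]
    refine Finset.sum_congr rfl fun i _ => ?_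
    rw [intervalIntegral.integral_finsetSum fun j _ => hterm i j]
    refine Finset.sum_congr rfl fun j _ => ?_
    rw [intervalIntegral.integral_const_mul, (hint i j).2]
  rw [ge_iff_le, hent, intervalIntegral.integral_of_le zero_le_one,
    intervalIntegral.integral_of_le zero_le_one, integral_Ioc_eq_integral_Ioo,
    integral_Ioc_eq_integral_Ioo]
  refine integral_mono_of_nonneg ?_ ?_ ?_
  · filter_upwards [ae_restrict_mem measurableSet_Ioo] with t ht
    exact div_nonneg (mul_nonneg ht.1.le (sq_nonneg x)) (hden t ht).le
  · exact ((intervalIntegrable_iff_integrableOn_Ioc_of_le zero_le_one).1 hfull).mono_set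
      Set.Ioo_subset_Ioc_self
  · filter_upwards [ae_restrict_mem measurableSet_Ioo] with t ht
    let c : ℝ := (1 - t) * (trace (ρ' * Q)).re + t * (trace (ρ * Q)).re
    have hcs := hρ'.sq_re_trace_sub_mul_le hρ (hshift c) ht
    have hxc : (trace ((ρ' - ρ) * (Q - (c : ℂ) • 1))).re = x := by
      rw [hx, Matrix.mul_sub, trace_sub, Matrix.mul_smul, Matrix.mul_one, trace_smul, trace_sub,
        hρ'tr, hρtr]
      simp
    have hvar : (1 - t) * (trace (ρ' * ((Q - (c : ℂ) • 1) * (Q - (c : ℂ) • 1)))).re +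
        t * (trace (ρ * ((Q - (c : ℂ) • 1) * (Q - (c : ℂ) • 1)))).re =
        (1 - t) * v' + t * v + t * (1 - t) * x ^ 2 := by
      rw [hv', hv, hx, qVar, qVar, re_trace_mul_sub_smul_one_sq hρ'tr,
        re_trace_mul_sub_smul_one_sq hρtr, re_trace_mul_sub_smul_one_sq hρ'tr,
        re_trace_mul_sub_smul_one_sq hρtr, Matrix.sub_mul, trace_sub, Complex.sub_re]
      simp only [c]
      ring
    rw [hxc, hvar] at hcs
    rw [div_le_iff₀ (hden t ht)]
    refine (mul_le_mul_of_nonneg_left hcs ht.1.le).trans_eq ?_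
    rw [← mul_assoc, Finset.mul_sum]
    congr 1
    refine Finset.sum_congr rfl fun i _ => ?_
    rw [Finset.mul_sum]
    exact Finset.sum_congr rfl fun j _ => by simp only [w, p, q]; ring
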